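/- Let u_S: 𝔻 → S⁴ ⊂ ℝ ⊕ ℂ ⊕ ℂ be given by u_S(z) = ( (|z|⁴−3)/(|z|⁴+3), 0, 2√3 z²/(|z|⁴+3) ). Then the Dirichlet energy of u_S over the unit disc equals 2π, i.e. (1/2)∫_𝔻 |∇u_S|² dx = 2π. -/

import Mathlib

open Complex MeasureTheory

/-- The components of the harmonic map `u_S(z) = ((|z|⁴−3)/(|z|⁴+3), 0, 2√3 z²/(|z|⁴+3))`. -/
noncomputable def uS0 (z : ℂ) : ℝ := (‖z‖ ^ 4 - 3) / (‖z‖ ^ 4 + 3)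

noncomputable def uS1 (_ : ℂ) : ℂ := 0

noncomputable def uS2 (z : ℂ) : ℂ := 2 * Real.sqrt 3 * z ^ 2 / ((‖z‖ : ℂ) ^ 4 + 3)

/-- The Dirichlet energy density `(1/2)|∇u_S|²`, with
`|∇u|² = |∂₁u|² + |∂₂u|²` computed in the directions `1, i` of `ℂ ≅ ℝ²`. -/
noncomputable def uS_density (z : ℂ) : ℝ :=
  (fderiv ℝ uS0 z 1) ^ 2 + (fderiv ℝ uS0 z Complex.I) ^ 2
    + ‖fderiv ℝ uS1 z 1‖ ^ 2 + ‖fderiv ℝ uS1 z Complex.I‖ ^ 2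
    + ‖fderiv ℝ uS2 z 1‖ ^ 2 + ‖fderiv ℝ uS2 z Complex.I‖ ^ 2

lemma hasFDerivAt_N (z : ℂ) : HasFDerivAt (fun z : ℂ => z.re ^ 2 + z.im ^ 2)
    ((2 * z.re) • reCLM + (2 * z.im) • imCLM) z := by
  have h1 : HasFDerivAt (fun z : ℂ => z.re) reCLM z := reCLM.hasFDerivAt
  have h2 : HasFDerivAt (fun z : ℂ => z.im) imCLM z := imCLM.hasFDerivAt
  refine ((h1.pow 2).add (h2.pow 2)).congr_fderiv ?_
  ext <;> simp

lemma norm_four (z : ℂ) : ‖z‖ ^ 4 = (z.re ^ 2 + z.im ^ 2) ^ 2 := by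
  have : ‖z‖ ^ 2 = z.re ^ 2 + z.im ^ 2 := by
    rw [Complex.sq_norm, Complex.normSq_apply]; ring
  rw [← this]; ring

lemma fderiv_uS0 (z v : ℂ) : fderiv ℝ uS0 z v =
    (12 * (z.re ^ 2 + z.im ^ 2) / ((z.re ^ 2 + z.im ^ 2) ^ 2 + 3) ^ 2)
      * (2 * z.re * v.re + 2 * z.im * v.im) := by
  have e : uS0 = (fun n : ℝ => (n ^ 2 - 3) / (n ^ 2 + 3)) ∘
      (fun z : ℂ => z.re ^ 2 + z.im ^ 2) := by
    funext z; simp [uS0, norm_four]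
  have hg : ∀ n : ℝ, HasDerivAt (fun n : ℝ => (n ^ 2 - 3) / (n ^ 2 + 3))
      (12 * n / (n ^ 2 + 3) ^ 2) n := by
    intro n
    have h := (((hasDerivAt_id n).pow 2).sub_const 3).div
      (((hasDerivAt_id n).pow 2).add_const 3) (by simp only [id, Pi.pow_apply]; positivity)
    refine h.congr_deriv ?_
    simp
    ring
  rw [e, ((hg _).comp_hasFDerivAt z (hasFDerivAt_N z)).fderiv]
  simp
  ring

lemma fderiv_uS2 (z v : ℂ) : fderiv ℝ uS2 z v =
    ((2 * Real.sqrt 3 / ((z.re ^ 2 + z.im ^ 2) ^ 2 + 3) : ℝ) : ℂ) * (2 * z * v) +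
    ((-(4 * Real.sqrt 3) * (z.re ^ 2 + z.im ^ 2) / ((z.re ^ 2 + z.im ^ 2) ^ 2 + 3) ^ 2
      * (2 * z.re * v.re + 2 * z.im * v.im) : ℝ) : ℂ) * z ^ 2 := by
  have e : uS2 = fun z => ((fun n : ℝ => 2 * Real.sqrt 3 / (n ^ 2 + 3)) ∘
      (fun z : ℂ => z.re ^ 2 + z.im ^ 2)) z • z ^ 2 := by
    funext z
    have := norm_four z
    simp only [uS2, Function.comp, real_smul, ← this]
    push_cast
    ring
  have hg : ∀ n : ℝ, HasDerivAt (fun n : ℝ => 2 * Real.sqrt 3 / (n ^ 2 + 3))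
      (-(4 * Real.sqrt 3) * n / (n ^ 2 + 3) ^ 2) n := by
    intro n
    have h := (hasDerivAt_const n (2 * Real.sqrt 3)).div
      (((hasDerivAt_id n).pow 2).add_const 3) (by simp only [id, Pi.pow_apply]; positivity)
    refine h.congr_deriv ?_
    simp
    ring
  have hz : HasFDerivAt (fun z : ℂ => z ^ 2) _ z := (hasFDerivAt_id (𝕜 := ℝ) z).pow 2
  have hh := (((hg _).comp_hasFDerivAt z (hasFDerivAt_N z)).smul hz).fderiv
  rw [e]
  refine (congrArg (fun L => L v) hh).trans ?_
  simp only [Function.comp, ContinuousLinearMap.add_apply, ContinuousLinearMap.smul_apply,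
    ContinuousLinearMap.smulRight_apply, real_smul, smul_eq_mul, reCLM_apply, imCLM_apply,
    ContinuousLinearMap.id_apply, id]
  push_cast
  ring

lemma normSq_sum (z : ℂ) (a b : ℝ) :
    normSq ((a : ℂ) * (2 * z * 1) + ((b * (2 * z.re * (1 : ℂ).re + 2 * z.im * (1 : ℂ).im) : ℝ) : ℂ)
      * z ^ 2) +
    normSq ((a : ℂ) * (2 * z * I) + ((b * (2 * z.re * I.re + 2 * z.im * I.im) : ℝ) : ℂ)
      * z ^ 2) =
    8 * a ^ 2 * (z.re ^ 2 + z.im ^ 2) + 8 * a * b * (z.re ^ 2 + z.im ^ 2) ^ 2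
      + 4 * b ^ 2 * (z.re ^ 2 + z.im ^ 2) ^ 3 := by
  obtain ⟨x, y⟩ := z
  simp only [Complex.normSq_apply, add_re, add_im, ofReal_re, ofReal_im, pow_two, mul_re,
    mul_im, I_re, I_im, one_re, one_im, re_ofNat, im_ofNat]
  ring

lemma density_eq (z : ℂ) : uS_density z = 96 * ‖z‖ ^ 2 / (‖z‖ ^ 4 + 3) ^ 2 := by
  have h1 : ∀ v, fderiv ℝ uS1 z v = 0 := by
    intro v
    have : uS1 = fun _ => (0 : ℂ) := rfl
    rw [this]; simp
  have h3 : Real.sqrt 3 ^ 2 = 3 := Real.sq_sqrt (by norm_num)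
  have hn : ‖z‖ ^ 2 = z.re ^ 2 + z.im ^ 2 := by
    rw [Complex.sq_norm, Complex.normSq_apply]; ring
  have hs := normSq_sum z (2 * Real.sqrt 3 / ((z.re ^ 2 + z.im ^ 2) ^ 2 + 3))
    (-(4 * Real.sqrt 3) * (z.re ^ 2 + z.im ^ 2) / ((z.re ^ 2 + z.im ^ 2) ^ 2 + 3) ^ 2)
  rw [hn, norm_four]
  simp only [uS_density, h1, fderiv_uS0, fderiv_uS2]
  rw [add_assoc, Complex.sq_norm (_ + _), Complex.sq_norm (_ + _), hs]
  have h0 : ∀ c : ℝ, (c * (2 * z.re * (1 : ℂ).re + 2 * z.im * (1 : ℂ).im)) ^ 2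
      + (c * (2 * z.re * I.re + 2 * z.im * I.im)) ^ 2 = 4 * c ^ 2 * (z.re ^ 2 + z.im ^ 2) := by
    intro c; simp; ring
  rw [h0]
  generalize z.re ^ 2 + z.im ^ 2 = n
  have hD : n ^ 2 + 3 ≠ 0 := by positivity
  generalize Real.sqrt 3 = s at *
  have e1 : (2 * s / (n ^ 2 + 3)) ^ 2 = 12 / (n ^ 2 + 3) ^ 2 := by
    rw [div_pow, mul_pow, h3]; norm_num
  have e2 : 8 * (2 * s / (n ^ 2 + 3)) * (-(4 * s) * n / (n ^ 2 + 3) ^ 2)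
      = -192 * n / (n ^ 2 + 3) ^ 3 := by
    have : 8 * (2 * s / (n ^ 2 + 3)) * (-(4 * s) * n / (n ^ 2 + 3) ^ 2)
      = -64 * s ^ 2 * n / (n ^ 2 + 3) ^ 3 := by field_simp; ring
    rw [this, h3]; norm_num
  have e3 : (-(4 * s) * n / (n ^ 2 + 3) ^ 2) ^ 2 = 48 * n ^ 2 / (n ^ 2 + 3) ^ 4 := by
    have : (-(4 * s) * n / (n ^ 2 + 3) ^ 2) ^ 2 = 16 * s ^ 2 * n ^ 2 / (n ^ 2 + 3) ^ 4 := by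
      field_simp; ring
    rw [this, h3]; norm_num
  rw [e1, e2, e3]
  simp only [norm_zero]
  field_simp
  ring

/-- The Dirichlet energy of `u_S` over the unit disc equals `2π`. -/
theorem dirichlet_energy_uS :
    (1 / 2) * ∫ z in Metric.ball (0 : ℂ) 1, uS_density z = 2 * Real.pi := by
  have hI : ∫ z in Metric.ball (0 : ℂ) 1, uS_density z =
      ∫ z : ℂ, (Set.Iio (1 : ℝ)).indicator (fun r => 96 * r ^ 2 / (r ^ 4 + 3) ^ 2) ‖z‖ := by
    rw [← integral_indicator Metric.isOpen_ball.measurableSet]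
    congr 1
    funext z
    by_cases h : ‖z‖ < 1 <;> simp [Set.indicator, h, density_eq]
  have hF : ∀ r : ℝ, HasDerivAt (fun r : ℝ => -24 / (r ^ 4 + 3))
      (r * (96 * r ^ 2 / (r ^ 4 + 3) ^ 2)) r := by
    intro r
    have h := (hasDerivAt_const r (-24 : ℝ)).div
      (((hasDerivAt_id r).pow 4).add_const 3) (by simp only [id, Pi.pow_apply]; positivity)
    refine h.congr_deriv ?_
    simp
    ring
  have hJ : ∫ r in Set.Ioi (0 : ℝ), r * (Set.Iio (1 : ℝ)).indicator
      (fun r => 96 * r ^ 2 / (r ^ 4 + 3) ^ 2) r = 2 := by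
    have : ∀ r : ℝ, r * (Set.Iio (1 : ℝ)).indicator
      (fun r => 96 * r ^ 2 / (r ^ 4 + 3) ^ 2) r = (Set.Iio (1 : ℝ)).indicator
      (fun r => r * (96 * r ^ 2 / (r ^ 4 + 3) ^ 2)) r := by
      intro r; by_cases h : r < 1 <;> simp [Set.indicator, h]
    simp only [this]
    rw [setIntegral_indicator measurableSet_Iio, Set.Ioi_inter_Iio,
      ← integral_Ioc_eq_integral_Ioo, ← intervalIntegral.integral_of_le zero_le_one,
      intervalIntegral.integral_eq_sub_of_hasDerivAt (fun r _ => hF r)]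
    · norm_num
    · apply Continuous.intervalIntegrable
      have : ∀ r : ℝ, (r ^ 4 + 3) ^ 2 ≠ 0 := fun r => by positivity
      fun_prop (disch := exact this _)
  rw [hI, integral_fun_norm_addHaar]
  simp [Complex.finrank_real_complex, Measure.real, hJ]
  try ring
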